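/- Let Z be a nonempty, locally connected topological space and let f : Z → ℝ be a continuous map that is proper (the preimage of every compact subset of ℝ is compact) and bounded below. If the set N = {z ∈ Z : z is a local minimum point of f} is a connected subset of Z, then Z is connected. -/

import Mathlib

/-- A continuous proper function that is bounded below has a local minimum point in every
nonempty clopen set. -/
theorem IsClopen.exists_isLocalMin_of_proper {Z : Type*} [TopologicalSpace Z] {f : Z → ℝ}
    (hf : Continuous f) (hproper : ∀ K : Set ℝ, IsCompact K → IsCompact (f ⁻¹' K))
    (hbdd : BddBelow (Set.range f)) {C : Set Z} (hC : IsClopen C) (hne : C.Nonempty) :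
    ∃ z ∈ C, IsLocalMin f z := by
  obtain ⟨b, hb⟩ := hbdd
  obtain ⟨x, hx⟩ := hne
  have hb' (y : Z) : b ≤ f y := hb ⟨y, rfl⟩
  obtain ⟨z, ⟨hzf, hzC⟩, hz⟩ := ((hproper _ isCompact_Icc).inter_right hC.isClosed).exists_isMinOn
    ⟨x, (⟨hb' x, le_rfl⟩ : f x ∈ Set.Icc b (f x)), hx⟩ hf.continuousOn
  refine ⟨z, hzC, Filter.mem_of_superset (hC.isOpen.mem_nhds hzC) fun y hy => ?_⟩
  rcases le_total (f y) (f x) with h | h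
  · exact hz ⟨⟨hb' y, h⟩, hy⟩
  · exact hzf.2.trans h

/-- Let `Z` be a nonempty, locally connected topological space and
`f : Z → ℝ` a continuous map that is proper (preimages of compact sets are compact)
and bounded below.  If the set of local minimum points of `f` is a connected subset
of `Z`, then `Z` is connected.  (Proposition 4.2 of the paper.) -/
theorem hitchin_function_connectedness
    {Z : Type*} [TopologicalSpace Z] [Nonempty Z] [LocallyConnectedSpace Z]
    (f : Z → ℝ) (hf : Continuous f)
    (hproper : ∀ K : Set ℝ, IsCompact K → IsCompact (f ⁻¹' K))
    (hbdd : BddBelow (Set.range f))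
    (hN : IsConnected {z : Z | IsLocalMin f z}) :
    ConnectedSpace Z := by
  have subset_of_clopen {C : Set Z} (hC : IsClopen C) (hne : C.Nonempty) :
      {z : Z | IsLocalMin f z} ⊆ C := by
    obtain ⟨z, hzC, hz⟩ := hC.exists_isLocalMin_of_proper hf hproper hbdd hne
    exact hN.isPreconnected.subset_isClopen hC ⟨z, hz, hzC⟩
  have : PreconnectedSpace Z := preconnectedSpace_iff_clopen.2 fun C hC => by
    by_contra! h
    obtain ⟨z, hz⟩ := hN.nonempty
    exact subset_of_clopen hC.compl (Set.nonempty_compl.2 h.2) hz (subset_of_clopen hC h.1 hz)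
  exact ⟨inferInstance⟩
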